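/- For −1 < r < 1 define θ = μ(1−r,1+r), ξ = μ(1−r,1−r,1+r), η = μ(1−r,1+r,1+r), Γ = (r/4)(η−ξ)/θ, and Δ = (r/4)(ξ/(1−r) − η/(1+r)). Then 0 ≤ 2Γ ≤ Δ and (1−θ)² ≤ 2Δ. -/

import Mathlib

/-- The logarithmic mean `μ(x,y) = ∫₀¹ x^{1−α} y^α dα`. -/
noncomputable def logMean (x y : ℝ) : ℝ := ∫ α in (0:ℝ)..1, x ^ (1 - α) * y ^ α

/-- The three-variable logarithmic mean `μ(x,y,z) = 2∫₀¹∫₀^α x^{1−α} y^{α−β} z^β dβ dα`. -/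
noncomputable def logMean₃ (x y z : ℝ) : ℝ :=
  2 * ∫ α in (0:ℝ)..1, ∫ β in (0:ℝ)..α, x ^ (1 - α) * y ^ (α - β) * z ^ β

theorem rpow_one_sub_mul_rpow {x y : ℝ} (hx : 0 < x) (hy : 0 < y) (a : ℝ) :
    x ^ (1 - a) * y ^ a = x * Real.exp (Real.log (y / x) * a) := by
  rw [Real.rpow_sub hx, Real.rpow_one, ← Real.rpow_def_of_pos (div_pos hy hx),
    Real.div_rpow hy.le hx.le]
  ring

theorem log_div_ne_zero {x y : ℝ} (hx : 0 < x) (hy : 0 < y) (hxy : x ≠ y) :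
    Real.log (y / x) ≠ 0 := by
  refine Real.log_ne_zero_of_pos_of_ne_one (div_pos hy hx) fun h => hxy ?_
  rw [div_eq_one_iff_eq hx.ne'] at h
  exact h.symm

theorem hasDerivAt_exp_mul_div {c : ℝ} (hc : c ≠ 0) (t : ℝ) :
    HasDerivAt (fun t => Real.exp (c * t) / c) (Real.exp (c * t)) t := by
  refine (((hasDerivAt_id t).const_mul c).exp.div_const c).congr_deriv ?_
  simp only [id]
  field_simp

theorem integral_exp_mul_zero {c : ℝ} (hc : c ≠ 0) (a : ℝ) :
    ∫ t in (0:ℝ)..a, Real.exp (c * t) = (Real.exp (c * a) - 1) / c := by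
  rw [intervalIntegral.integral_eq_sub_of_hasDerivAt
    (fun t _ => hasDerivAt_exp_mul_div hc t)
    (Continuous.intervalIntegrable (by fun_prop) _ _)]
  simp only [mul_zero, Real.exp_zero]
  ring

theorem integral_id_mul_exp_mul {c : ℝ} (hc : c ≠ 0) :
    ∫ t in (0:ℝ)..1, t * Real.exp (c * t) =
      Real.exp c / c - (Real.exp c - 1) / c ^ 2 := by
  have h (t : ℝ) : HasDerivAt
      (fun t => t * (Real.exp (c * t) / c) - Real.exp (c * t) / c / c)
      (t * Real.exp (c * t)) t := by
    refine (((hasDerivAt_id t).mul (hasDerivAt_exp_mul_div hc t)).sub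
      ((hasDerivAt_exp_mul_div hc t).div_const c)).congr_deriv ?_
    simp only [id]
    ring
  rw [intervalIntegral.integral_eq_sub_of_hasDerivAt (fun t _ => h t)
    (Continuous.intervalIntegrable (by fun_prop) _ _)]
  simp only [mul_zero, mul_one, Real.exp_zero]
  field_simp
  ring

theorem logMean_eq {x y : ℝ} (hx : 0 < x) (hy : 0 < y) (hxy : x ≠ y) :
    logMean x y = (y - x) / Real.log (y / x) := by
  have hL := log_div_ne_zero hx hy hxy
  simp only [logMean, rpow_one_sub_mul_rpow hx hy]
  rw [intervalIntegral.integral_const_mul, integral_exp_mul_zero hL, mul_one,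
    Real.exp_log (div_pos hy hx)]
  field_simp

theorem logMean₃_left_eq {x y : ℝ} (hx : 0 < x) (hy : 0 < y) (hxy : x ≠ y) :
    logMean₃ x x y = 2 * ((y - x) / Real.log (y / x) - x) / Real.log (y / x) := by
  have hL := log_div_ne_zero hx hy hxy
  have h (a b : ℝ) : x ^ (1 - a) * x ^ (a - b) * y ^ b =
      x * Real.exp (Real.log (y / x) * b) := by
    rw [← Real.rpow_add hx, sub_add_sub_cancel, rpow_one_sub_mul_rpow hx hy]
  simp only [logMean₃, h, intervalIntegral.integral_const_mul, integral_exp_mul_zero hL,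
    intervalIntegral.integral_div]
  rw [intervalIntegral.integral_sub (Continuous.intervalIntegrable (by fun_prop) _ _)
    (by simp), integral_exp_mul_zero hL, mul_one, Real.exp_log (div_pos hy hx)]
  simp only [intervalIntegral.integral_const, sub_zero, smul_eq_mul, mul_one]
  field_simp

theorem logMean₃_right_eq {x y : ℝ} (hx : 0 < x) (hy : 0 < y) (hxy : x ≠ y) :
    logMean₃ x y y = 2 * (y - (y - x) / Real.log (y / x)) / Real.log (y / x) := by
  have hL := log_div_ne_zero hx hy hxy
  have h (a b : ℝ) : x ^ (1 - a) * y ^ (a - b) * y ^ b =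
      x * Real.exp (Real.log (y / x) * a) := by
    rw [mul_assoc, ← Real.rpow_add hy, sub_add_cancel, rpow_one_sub_mul_rpow hx hy]
  simp only [logMean₃, h, intervalIntegral.integral_const, sub_zero, smul_eq_mul,
    mul_left_comm _ x, intervalIntegral.integral_const_mul, integral_id_mul_exp_mul hL,
    Real.exp_log (div_pos hy hx)]
  field_simp

theorem hasDerivAt_log_one_add_div_one_sub {r : ℝ} (hr : -1 < r) (hr' : r < 1) :
    HasDerivAt (fun r : ℝ => Real.log ((1 + r) / (1 - r))) (2 / (1 - r ^ 2)) r := by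
  have h1 : 1 - r ≠ 0 := by linarith
  have h2 : 1 + r ≠ 0 := by linarith
  refine ((((hasDerivAt_id r).const_add 1).div ((hasDerivAt_id r).const_sub 1) h1).log
    (div_ne_zero h2 h1)).congr_deriv ?_
  simp only [id, Pi.div_apply]
  rw [show 1 - r ^ 2 = (1 - r) * (1 + r) by ring]
  field_simp
  ring

theorem two_mul_le_log_one_add_div_one_sub {r : ℝ} (hr : 0 ≤ r) (hr' : r < 1) :
    2 * r ≤ Real.log ((1 + r) / (1 - r)) := by
  have hd (t : ℝ) (ht : t ∈ Set.Ico (0 : ℝ) 1) :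
      HasDerivAt (fun t : ℝ => Real.log ((1 + t) / (1 - t)) - 2 * t)
        (2 / (1 - t ^ 2) - 2 * 1) t :=
    (hasDerivAt_log_one_add_div_one_sub (by linarith [ht.1]) ht.2).sub
      ((hasDerivAt_id t).const_mul 2)
  have hm : MonotoneOn (fun t : ℝ => Real.log ((1 + t) / (1 - t)) - 2 * t)
      (Set.Ico 0 1) := by
    refine monotoneOn_of_hasDerivWithinAt_nonneg (convex_Ico 0 1)
      (fun t ht => (hd t ht).continuousAt.continuousWithinAt)
      (fun t ht => (hd t (interior_subset ht)).hasDerivWithinAt) fun t ht => ?_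
    obtain ⟨h0, h1⟩ := interior_subset ht
    have hs : 0 < 1 - t ^ 2 := by nlinarith
    rw [sub_nonneg, le_div_iff₀ hs]
    nlinarith
  have := hm (Set.left_mem_Ico.2 one_pos) ⟨hr, hr'⟩ hr
  norm_num at this
  linarith

theorem log_one_add_div_one_sub_le {r : ℝ} (hr : 0 ≤ r) (hr' : r < 1) :
    Real.log ((1 + r) / (1 - r)) ≤ 2 * (r * (1 - r ^ 2) ^ (-1 / 3 : ℝ)) := by
  have hd (t : ℝ) (ht : t ∈ Set.Ico (0 : ℝ) 1) :
      HasDerivAt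
        (fun t : ℝ => 2 * (t * (1 - t ^ 2) ^ (-1 / 3 : ℝ)) - Real.log ((1 + t) / (1 - t)))
        (2 * (1 * (1 - t ^ 2) ^ (-1 / 3 : ℝ) +
          t * (-(2 * t) * (-1 / 3) * (1 - t ^ 2) ^ (-1 / 3 - 1 : ℝ))) -
            2 / (1 - t ^ 2)) t := by
    have hs : 1 - t ^ 2 ≠ 0 := by nlinarith [ht.1, ht.2]
    have hp : HasDerivAt (fun t : ℝ => 1 - t ^ 2) (-(2 * t)) t := by
      simpa using (hasDerivAt_pow 2 t).const_sub 1
    exact (((hasDerivAt_id t).mul (hp.rpow_const (Or.inl hs))).const_mul 2).sub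
      (hasDerivAt_log_one_add_div_one_sub (by linarith [ht.1]) ht.2)
  have hm : MonotoneOn
      (fun t : ℝ => 2 * (t * (1 - t ^ 2) ^ (-1 / 3 : ℝ)) - Real.log ((1 + t) / (1 - t)))
      (Set.Ico 0 1) := by
    refine monotoneOn_of_hasDerivWithinAt_nonneg (convex_Ico 0 1)
      (fun t ht => (hd t ht).continuousAt.continuousWithinAt)
      (fun t ht => (hd t (interior_subset ht)).hasDerivWithinAt) fun t ht => ?_
    obtain ⟨h0, h1⟩ := interior_subset ht
    have hs : 0 < 1 - t ^ 2 := by nlinarith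
    have hb : (1 - t ^ 2) ^ (1 / 3 : ℝ) ≤ 1 - t ^ 2 / 3 := by
      have := rpow_one_add_le_one_add_mul_self (s := -t ^ 2) (p := 1 / 3)
        (by linarith) (by norm_num) (by norm_num)
      rw [← sub_eq_add_neg] at this
      linarith
    have hu : 0 < (1 - t ^ 2) ^ (1 / 3 : ℝ) := Real.rpow_pos_of_pos hs _
    rw [Real.rpow_sub hs, Real.rpow_one, neg_div, Real.rpow_neg hs.le]
    have key : 2 * (1 * ((1 - t ^ 2) ^ (1 / 3 : ℝ))⁻¹ +
          t * (-(2 * t) * -(1 / 3) * (((1 - t ^ 2) ^ (1 / 3 : ℝ))⁻¹ / (1 - t ^ 2)))) -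
            2 / (1 - t ^ 2) =
        2 * (1 - t ^ 2 / 3 - (1 - t ^ 2) ^ (1 / 3 : ℝ)) /
          ((1 - t ^ 2) * (1 - t ^ 2) ^ (1 / 3 : ℝ)) := by
      generalize (1 - t ^ 2) ^ (1 / 3 : ℝ) = u at hu
      field_simp
      ring
    rw [key]
    exact div_nonneg (by linarith) (by positivity)
  have := hm (Set.left_mem_Ico.2 one_pos) ⟨hr, hr'⟩ hr
  norm_num at this
  norm_num
  linarith

theorem logMean_comm (x y : ℝ) : logMean x y = logMean y x := by
  have h := intervalIntegral.integral_comp_sub_left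
    (fun a : ℝ => y ^ (1 - a) * x ^ a) (a := 0) (b := 1) 1
  simp only [sub_sub_cancel, sub_zero, sub_self] at h
  rw [logMean, logMean, ← h]
  simp only [mul_comm]

theorem logMean_one_sub_one_add_of_pos {r : ℝ} (hr : 0 < r) (hr' : r < 1) :
    0 < logMean (1 - r) (1 + r) ∧ logMean (1 - r) (1 + r) ≤ 1 ∧
      1 - r ^ 2 ≤ logMean (1 - r) (1 + r) ^ 3 := by
  have hs : 0 < 1 - r ^ 2 := by nlinarith
  have h1 := two_mul_le_log_one_add_div_one_sub hr.le hr'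
  have h2 := log_one_add_div_one_sub_le hr.le hr'
  rw [logMean_eq (by linarith) (by linarith) (by linarith),
    show 1 + r - (1 - r) = 2 * r by ring]
  set L := Real.log ((1 + r) / (1 - r))
  have hL : 0 < L := by linarith
  refine ⟨by positivity, (div_le_one hL).2 h1, ?_⟩
  have hv : ((1 - r ^ 2) ^ (-1 / 3 : ℝ)) ^ 3 = (1 - r ^ 2)⁻¹ := by
    rw [← Real.rpow_natCast, ← Real.rpow_mul hs.le, ← Real.rpow_neg_one]
    norm_num
  have h3 : L ^ 3 ≤ (2 * r) ^ 3 * (1 - r ^ 2)⁻¹ := by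
    rw [← hv, ← mul_pow, mul_assoc]
    exact pow_le_pow_left₀ hL.le h2 3
  rw [div_pow, le_div_iff₀ (by positivity), mul_comm]
  exact (le_div_iff₀ hs).1 h3

theorem logMean_one_sub_one_add {r : ℝ} (hr : -1 < r) (hr' : r < 1) (h0 : r ≠ 0) :
    0 < logMean (1 - r) (1 + r) ∧ logMean (1 - r) (1 + r) ≤ 1 ∧
      1 - r ^ 2 ≤ logMean (1 - r) (1 + r) ^ 3 := by
  rcases h0.lt_or_gt with h | h
  · have := logMean_one_sub_one_add_of_pos (r := -r) (by linarith) (by linarith)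
    rwa [sub_neg_eq_add, ← sub_eq_add_neg, logMean_comm, neg_sq] at this
  · exact logMean_one_sub_one_add_of_pos h hr'

/-- For `-1 < r < 1`, with `θ = μ(1−r,1+r)`, `ξ = μ(1−r,1−r,1+r)`, `η = μ(1−r,1+r,1+r)`,
`Γ = (r/4)(η−ξ)/θ` and `Δ = (r/4)(ξ/(1−r) − η/(1+r))`, one has `0 ≤ 2Γ ≤ Δ`
and `(1−θ)² ≤ 2Δ`. -/
theorem logMean_Gamma_Delta_inequalities (r : ℝ) (hr : -1 < r) (hr' : r < 1) :
    0 ≤ 2 * (r / 4 * ((logMean₃ (1-r) (1+r) (1+r) - logMean₃ (1-r) (1-r) (1+r)) /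
        logMean (1-r) (1+r))) ∧
    2 * (r / 4 * ((logMean₃ (1-r) (1+r) (1+r) - logMean₃ (1-r) (1-r) (1+r)) /
        logMean (1-r) (1+r))) ≤
      r / 4 * (logMean₃ (1-r) (1-r) (1+r) / (1-r) - logMean₃ (1-r) (1+r) (1+r) / (1+r)) ∧
    (1 - logMean (1-r) (1+r)) ^ 2 ≤
      2 * (r / 4 * (logMean₃ (1-r) (1-r) (1+r) / (1-r) -
        logMean₃ (1-r) (1+r) (1+r) / (1+r))) := by
  rcases eq_or_ne r 0 with rfl | h0
  · simp [logMean]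
  have hx : 0 < 1 - r := by linarith
  have hy : 0 < 1 + r := by linarith
  have hxy : 1 - r ≠ 1 + r := fun h => h0 (by linarith)
  have hs : 0 < 1 - r ^ 2 := by nlinarith
  obtain ⟨hpos, hle, hcube⟩ := logMean_one_sub_one_add hr hr' h0
  have hL := log_div_ne_zero hx hy hxy
  have hθ := logMean_eq hx hy hxy
  rw [logMean₃_left_eq hx hy hxy, logMean₃_right_eq hx hy hxy, ← hθ]
  set θ := logMean (1 - r) (1 + r)
  have hLθ : Real.log ((1 + r) / (1 - r)) = 2 * r / θ := by
    rw [eq_div_iff hpos.ne', hθ]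
    field_simp
    ring
  rw [hLθ]
  have hΓ : 2 * (r / 4 * ((2 * (1 + r - θ) / (2 * r / θ) -
      2 * (θ - (1 - r)) / (2 * r / θ)) / θ)) = 1 - θ := by
    field_simp
    ring
  have hΔ : r / 4 * (2 * (θ - (1 - r)) / (2 * r / θ) / (1 - r) -
      2 * (1 + r - θ) / (2 * r / θ) / (1 + r)) = θ / 4 * (2 * θ / (1 - r ^ 2) - 2) := by
    rw [show 1 - r ^ 2 = (1 - r) * (1 + r) by ring]
    field_simp
    ring
  rw [hΓ, hΔ]
  have hΓΔ : 1 - θ ≤ θ / 4 * (2 * θ / (1 - r ^ 2) - 2) := by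
    have h1 : 1 / θ ≤ θ ^ 2 / (1 - r ^ 2) := by
      rw [div_le_div_iff₀ hpos hs]
      linarith
    have h2 : 2 - θ ≤ 1 / θ := by
      rw [le_div_iff₀ hpos]
      nlinarith [sq_nonneg (θ - 1)]
    have h3 : θ / 4 * (2 * θ / (1 - r ^ 2) - 2) = θ ^ 2 / (1 - r ^ 2) / 2 - θ / 2 := by
      ring
    linarith
  exact ⟨by linarith, hΓΔ, by nlinarith⟩
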